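/- arXiv:1201.3381 — 2 statements merged into one kernel-verified Lean document; each statement's English description precedes it below -/
import Mathlib

section
/- (Subderivatives of the value function) Assume ψ is semi-concave and ‖∂²_{cc}V(x,c)‖ ≤ K for all (x,c) and some K ≥ 0. Then X(c) is nonempty for every c, and: (i) for every c, c' ∈ ℝ^M and every x(c) ∈ X(c), G(c') − G(c) ≤ ⟨∂_cV(x(c),c), c' − c⟩ + K‖c' − c‖²; in particular G is semi-concave and ∂_cV(x(c),c) is a subderivative of G at c; (ii) conversely, every subderivative of G at c belongs to the convex hull of the set { ∂_cV(x,c) : x ∈ X(c) }. -/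
open MeasureTheory
open scoped RealInnerProductSpace

noncomputable section

/-- `v ∈ ℤ^d`, i.e. `v` is an integer vector in `ℝ^d`. -/
def IsIntVec {d : ℕ} (v : EuclideanSpace ℝ (Fin d)) : Prop := ∀ i, ∃ k : ℤ, v i = (k : ℝ)

/-- `f` is `C`-semi-concave. -/
def SemiConcaveWith {E : Type*} [NormedAddCommGroup E] [NormedSpace ℝ E]
    (C : ℝ) (f : E → ℝ) : Prop :=
  ∀ x : E, ∃ l : E →L[ℝ] ℝ, ∀ y : E, f y - f x ≤ l (y - x) + C / 2 * ‖y - x‖ ^ 2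

/-- The value function `G(c) = inf_x (ψ(x) + V(x,c))`. -/
def valueFun {d M : ℕ} (ψ : EuclideanSpace ℝ (Fin d) → ℝ)
    (V : EuclideanSpace ℝ (Fin d) → EuclideanSpace ℝ (Fin M) → ℝ)
    (c : EuclideanSpace ℝ (Fin M)) : ℝ :=
  sInf (Set.range fun x => ψ x + V x c)

/-- The convex hull of a compact set in a finite-dimensional space is compact. -/
theorem isCompact_convexHull {E : Type*} [NormedAddCommGroup E] [NormedSpace ℝ E]
    [FiniteDimensional ℝ E] {s : Set E} (hs : IsCompact s) : IsCompact (convexHull ℝ s) := by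
  let f (k : ℕ) (p : (Fin k → ℝ) × (Fin k → E)) : E := ∑ i, p.1 i • p.2 i
  let T (k : ℕ) : Set E := f k '' (stdSimplex ℝ (Fin k) ×ˢ Set.univ.pi fun _ => s)
  have hT : ∀ k, IsCompact (T k) := fun k =>
    ((isCompact_stdSimplex ℝ (Fin k)).prod (isCompact_univ_pi fun _ => hs)).image
      (by fun_prop)
  have hUnion : convexHull ℝ s = ⋃ k ∈ Finset.range (Module.finrank ℝ E + 2), T k := by
    apply Set.Subset.antisymm
    · intro x hx
      obtain ⟨ι, _, z, w, hz, hind, hw, hw1, rfl⟩ := eq_pos_convex_span_of_mem_convexHull hx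
      have hcard := hind.card_le_finrank_succ
      have hrank := Submodule.finrank_le (vectorSpan ℝ (Set.range z))
      let e := Fintype.equivFin ι
      refine Set.mem_biUnion (x := Fintype.card ι)
        (by simp only [Finset.coe_range, Set.mem_Iio]; omega)
        ⟨(w ∘ e.symm, z ∘ e.symm),
          ⟨⟨fun i => (hw _).le, ?_⟩, fun i _ => hz ⟨_, rfl⟩⟩, ?_⟩
      · exact (e.symm.sum_comp w).trans hw1
      · exact e.symm.sum_comp fun i => w i • z i
    · refine Set.iUnion₂_subset fun k _ => ?_
      rintro _ ⟨⟨w, z⟩, ⟨⟨hw, hw1⟩, hz⟩, rfl⟩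
      exact (convex_convexHull ℝ s).sum_mem (fun i _ => hw i) hw1
        fun i _ => subset_convexHull ℝ s (hz i trivial)
  rw [hUnion]
  exact Finset.isCompact_biUnion _ fun k _ => hT k

/-- The unit cube `[0,1]^d`. -/
def unitCube (d : ℕ) : Set (EuclideanSpace ℝ (Fin d)) := {x | ∀ i, x i ∈ Set.Icc (0 : ℝ) 1}

theorem isCompact_unitCube (d : ℕ) : IsCompact (unitCube d) := by
  have h := (isCompact_univ_pi fun _ : Fin d => isCompact_Icc (a := (0 : ℝ)) (b := 1)).image
    (PiLp.continuous_toLp 2 fun _ : Fin d => ℝ)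
  convert h using 1
  ext x
  constructor
  · exact fun hx => ⟨x.ofLp, fun i _ => hx i, rfl⟩
  · rintro ⟨y, hy, rfl⟩ i
    exact hy i trivial

theorem exists_add_mem_unitCube {d : ℕ} (x : EuclideanSpace ℝ (Fin d)) :
    ∃ v, IsIntVec v ∧ x + v ∈ unitCube d := by
  refine ⟨WithLp.toLp 2 fun i => ((-⌊x i⌋ : ℤ) : ℝ), fun i => ⟨_, rfl⟩, fun i => ?_⟩
  have h₁ := Int.floor_le (x i)
  have h₂ := Int.lt_floor_add_one (x i)
  simp only [PiLp.add_apply, Int.cast_neg, Set.mem_Icc]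
  constructor <;> linarith

/-- A continuous periodic function attains its minimum in the unit cube. -/
theorem exists_mem_unitCube_forall_le {d : ℕ} {f : EuclideanSpace ℝ (Fin d) → ℝ}
    (hf : Continuous f) (hper : ∀ x v, IsIntVec v → f (x + v) = f x) :
    ∃ x ∈ unitCube d, ∀ y, f x ≤ f y := by
  obtain ⟨v, -, hv⟩ := exists_add_mem_unitCube (0 : EuclideanSpace ℝ (Fin d))
  obtain ⟨x, hx, hmin⟩ := (isCompact_unitCube d).exists_isMinOn ⟨_, hv⟩ hf.continuousOn
  refine ⟨x, hx, fun y => ?_⟩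
  obtain ⟨w, hw, hyw⟩ := exists_add_mem_unitCube y
  rw [← hper y w hw]
  exact hmin hyw

/-- First-order Taylor estimate for a `C²` function with bounded second derivative. -/
theorem abs_sub_sub_inner_gradient_le {E : Type*} [NormedAddCommGroup E] [InnerProductSpace ℝ E]
    [CompleteSpace E] {f : E → ℝ} (hf : ContDiff ℝ 2 f) {K : ℝ}
    (hK : ∀ c, ‖iteratedFDeriv ℝ 2 f c‖ ≤ K) (c c' : E) :
    |f c' - f c - ⟪gradient f c, c' - c⟫| ≤ K * ‖c' - c‖ ^ 2 := by
  have hK0 : 0 ≤ K := (norm_nonneg _).trans (hK c)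
  have hdf : Differentiable ℝ f := hf.differentiable (by norm_num)
  have hddf : Differentiable ℝ (fderiv ℝ f) :=
    (hf.fderiv_right (m := 1) (by norm_num)).differentiable (by norm_num)
  have hbound : ∀ z, ‖fderiv ℝ (fderiv ℝ f) z‖ ≤ K := fun z => by
    have h := hK z
    rwa [← norm_iteratedFDeriv_fderiv (n := 1), norm_iteratedFDeriv_one] at h
  have hlip : ∀ z, ‖fderiv ℝ f z - fderiv ℝ f c‖ ≤ K * ‖z - c‖ := fun z =>
    convex_univ.norm_image_sub_le_of_norm_fderiv_le (fun y _ => hddf y) (fun y _ => hbound y)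
      trivial trivial
  have hmv := (convex_closedBall c ‖c' - c‖).norm_image_sub_le_of_norm_fderiv_le'
    (f := f) (φ := fderiv ℝ f c) (C := K * ‖c' - c‖) (x := c) (y := c') (fun y _ => hdf y)
    (fun z hz => (hlip z).trans (by
      gcongr
      simpa [dist_eq_norm] using hz))
    (Metric.mem_closedBall_self (norm_nonneg _)) (by simp [dist_eq_norm])
  have hinner : ⟪gradient f c, c' - c⟫ = fderiv ℝ f c (c' - c) := by
    simp [gradient, InnerProductSpace.toDual_symm_apply]
  rw [hinner, ← Real.norm_eq_abs]
  exact hmv.trans_eq (by ring)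

theorem valueFun_eq {d M : ℕ} {ψ : EuclideanSpace ℝ (Fin d) → ℝ}
    {V : EuclideanSpace ℝ (Fin d) → EuclideanSpace ℝ (Fin M) → ℝ} {c : EuclideanSpace ℝ (Fin M)}
    {x : EuclideanSpace ℝ (Fin d)} (hx : ∀ y, ψ x + V x c ≤ ψ y + V y c) :
    valueFun ψ V c = ψ x + V x c :=
  IsLeast.csInf_eq ⟨⟨x, rfl⟩, by rintro _ ⟨y, rfl⟩; exact hx y⟩

theorem continuous_gradient_right {E F : Type*} [NormedAddCommGroup E] [NormedSpace ℝ E]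
    [NormedAddCommGroup F] [InnerProductSpace ℝ F] [CompleteSpace F] {V : E → F → ℝ}
    (hV : ContDiff ℝ 2 fun p : E × F => V p.1 p.2) (c : F) :
    Continuous fun x => gradient (fun q => V x q) c := by
  have h : ContDiff ℝ 1 fun x => fderiv ℝ (fun q => V x q) c :=
    ContDiff.fderiv (f := V) (g := fun _ => c) hV contDiff_const (by norm_num)
  exact (InnerProductSpace.toDual ℝ F).symm.continuous.comp h.continuous

/-- For every direction `e`, a subderivative `v` of the value function dominates, along `e`, the
gradient of `V` at some minimizer. -/
theorem exists_minimizer_inner_gradient_le {d M : ℕ}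
    {ψ : EuclideanSpace ℝ (Fin d) → ℝ} (hψc : Continuous ψ)
    (hψper : ∀ x v, IsIntVec v → ψ (x + v) = ψ x)
    {V : EuclideanSpace ℝ (Fin d) → EuclideanSpace ℝ (Fin M) → ℝ}
    (hV : ContDiff ℝ 2 fun p : EuclideanSpace ℝ (Fin d) × EuclideanSpace ℝ (Fin M) => V p.1 p.2)
    (hVper : ∀ x v c, IsIntVec v → V (x + v) c = V x c)
    {K : ℝ} (hK : ∀ x c, ‖iteratedFDeriv ℝ 2 (fun c' => V x c') c‖ ≤ K)
    {c v : EuclideanSpace ℝ (Fin M)} {C : ℝ}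
    (hv : ∀ c', valueFun ψ V c' - valueFun ψ V c ≤ ⟪v, c' - c⟫ + C / 2 * ‖c' - c‖ ^ 2)
    (e : EuclideanSpace ℝ (Fin M)) :
    ∃ x, (∀ y, ψ x + V x c ≤ ψ y + V y c) ∧ ⟪gradient (fun q => V x q) c, e⟫ ≤ ⟪v, e⟫ := by
  have hVc := hV.continuous
  have hVx : ∀ x, ContDiff ℝ 2 (V x) := fun x => hV.comp (contDiff_const.prodMk contDiff_id)
  have hmin : ∀ c, ∃ x ∈ unitCube d, ∀ y, ψ x + V x c ≤ ψ y + V y c := fun c =>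
    exists_mem_unitCube_forall_le
      (hψc.add (hVc.comp (continuous_id.prodMk continuous_const)))
      fun x v hv => by rw [hψper x v hv, hVper x v c hv]
  let t : ℕ → ℝ := fun n => 1 / ((n : ℝ) + 1)
  have ht : Filter.Tendsto t Filter.atTop (nhds 0) := tendsto_one_div_add_atTop_nhds_zero_nat
  choose x hxQ hx using fun n => hmin (c + t n • e)
  obtain ⟨x₀, -, φ, hφ, hlim⟩ := (isCompact_unitCube d).tendsto_subseq hxQ
  have htφ := ht.comp hφ.tendsto_atTop
  have hc : Filter.Tendsto (fun n => c + t (φ n) • e) Filter.atTop (nhds c) := by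
    simpa using (tendsto_const_nhds (x := c)).add (htφ.smul_const e)
  refine ⟨x₀, fun y => ?_, ?_⟩
  · refine le_of_tendsto_of_tendsto' (b := Filter.atTop)
      (f := fun n => ψ (x (φ n)) + V (x (φ n)) (c + t (φ n) • e))
      (g := fun n => ψ y + V y (c + t (φ n) • e)) ?_ ?_ (fun n => hx (φ n) y)
    · exact ((hψc.tendsto x₀).comp hlim).add
        ((hVc.tendsto (x₀, c)).comp (hlim.prodMk_nhds hc))
    · exact tendsto_const_nhds.add
        ((hVc.tendsto (y, c)).comp (tendsto_const_nhds.prodMk_nhds hc))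
  · have hgrad := (continuous_gradient_right hV c).tendsto x₀
    refine le_of_tendsto_of_tendsto' (b := Filter.atTop)
      (f := fun n => ⟪gradient (fun q => V (x (φ n)) q) c, e⟫)
      (g := fun n => ⟪v, e⟫ + t (φ n) * ((C / 2 + K) * ‖e‖ ^ 2)) ?_ ?_ fun n => ?_
    · exact (hgrad.comp hlim).inner tendsto_const_nhds
    · simpa using (tendsto_const_nhds (x := ⟪v, e⟫)).add (htφ.mul_const ((C / 2 + K) * ‖e‖ ^ 2))
    · have htpos : 0 < t (φ n) := by positivity
      generalize hs : t (φ n) = s at htpos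
      have hmin' := hx (φ n)
      rw [hs] at hmin'
      obtain ⟨z, -, hz⟩ := hmin c
      have hsub := hv (c + s • e)
      have htaylor := (abs_le.1 (abs_sub_sub_inner_gradient_le (hVx (x (φ n))) (hK _)
        c (c + s • e))).1
      rw [valueFun_eq hmin', valueFun_eq hz] at hsub
      simp only [add_sub_cancel_left, inner_smul_right, norm_smul, mul_pow, Real.norm_eq_abs,
        sq_abs] at hsub htaylor
      have hle := hz (x (φ n))
      refine le_of_mul_le_mul_left ?_ htpos
      linarith

/-- **Subderivatives of the value function.** If `ψ` is continuous, periodic and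
semi-concave, and `‖∂²_{cc}V‖ ≤ K`, then: the set `X(c)` of minimizers of `H(·,c)` is
nonempty; for every minimizer `x(c)`,
`G(c') − G(c) ≤ ⟨∂_c V(x(c),c), c' − c⟩ + K‖c' − c‖²` (so `G` is semi-concave and
`∂_c V(x(c),c)` is a subderivative of `G` at `c`); and conversely every subderivative of
`G` at `c` lies in the convex hull of `{∂_c V(x,c) : x ∈ X(c)}`. -/
theorem subderivatives_of_value_function
    (d M : ℕ) (hd : 1 ≤ d)
    (ψ : EuclideanSpace ℝ (Fin d) → ℝ) (hψc : Continuous ψ)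
    (hψper : ∀ x v, IsIntVec v → ψ (x + v) = ψ x)
    (hψsc : ∃ C > 0, SemiConcaveWith C ψ)
    (V : EuclideanSpace ℝ (Fin d) → EuclideanSpace ℝ (Fin M) → ℝ)
    (hV : ContDiff ℝ 2 fun p : EuclideanSpace ℝ (Fin d) × EuclideanSpace ℝ (Fin M) =>
      V p.1 p.2)
    (hVper : ∀ x v c, IsIntVec v → V (x + v) c = V x c)
    (K : ℝ) (hK0 : 0 ≤ K)
    (hK : ∀ x c, ‖iteratedFDeriv ℝ 2 (fun c' => V x c') c‖ ≤ K) :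
    (∀ c : EuclideanSpace ℝ (Fin M), ∃ x, ∀ y, ψ x + V x c ≤ ψ y + V y c) ∧
    (∀ (c c' : EuclideanSpace ℝ (Fin M)) (x : EuclideanSpace ℝ (Fin d)),
      (∀ y, ψ x + V x c ≤ ψ y + V y c) →
      valueFun ψ V c' - valueFun ψ V c ≤
        ⟪gradient (fun q => V x q) c, c' - c⟫ + K * ‖c' - c‖ ^ 2) ∧
    SemiConcaveWith (2 * K) (valueFun ψ V) ∧
    ∀ (c : EuclideanSpace ℝ (Fin M)) (v : EuclideanSpace ℝ (Fin M)) (C' : ℝ),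
      (∀ c', valueFun ψ V c' - valueFun ψ V c ≤ ⟪v, c' - c⟫ + C' / 2 * ‖c' - c‖ ^ 2) →
      v ∈ convexHull ℝ
        {w : EuclideanSpace ℝ (Fin M) | ∃ x : EuclideanSpace ℝ (Fin d),
          (∀ y, ψ x + V x c ≤ ψ y + V y c) ∧ w = gradient (fun q => V x q) c} := by
  have hVc := hV.continuous
  have hVx : ∀ x, ContDiff ℝ 2 (V x) := fun x => hV.comp (contDiff_const.prodMk contDiff_id)
  have hHc : ∀ c, Continuous fun x => ψ x + V x c := fun c =>
    hψc.add (hVc.comp (continuous_id.prodMk continuous_const))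
  have hmin : ∀ c, ∃ x, ∀ y, ψ x + V x c ≤ ψ y + V y c := fun c => by
    obtain ⟨x, -, hx⟩ := exists_mem_unitCube_forall_le (hHc c)
      fun x v hv => by rw [hψper x v hv, hVper x v c hv]
    exact ⟨x, hx⟩
  have hupper : ∀ (c c' : EuclideanSpace ℝ (Fin M)) (x : EuclideanSpace ℝ (Fin d)),
      (∀ y, ψ x + V x c ≤ ψ y + V y c) →
      valueFun ψ V c' - valueFun ψ V c ≤
        ⟪gradient (fun q => V x q) c, c' - c⟫ + K * ‖c' - c‖ ^ 2 := fun c c' x hx => by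
    obtain ⟨x', hx'⟩ := hmin c'
    rw [valueFun_eq hx, valueFun_eq hx']
    have htaylor := (abs_le.1 (abs_sub_sub_inner_gradient_le (hVx x) (hK x) c c')).2
    have hle := hx' x
    linarith
  refine ⟨hmin, hupper, fun c => ?_, fun c v C' hv => ?_⟩
  · obtain ⟨x, hx⟩ := hmin c
    refine ⟨innerSL ℝ (gradient (fun q => V x q) c), fun c' => (hupper c c' x hx).trans_eq ?_⟩
    rw [innerSL_apply_apply]
    ring
  · set S := {w : EuclideanSpace ℝ (Fin M) | ∃ x : EuclideanSpace ℝ (Fin d),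
          (∀ y, ψ x + V x c ≤ ψ y + V y c) ∧ w = gradient (fun q => V x q) c}
    have hScompact : IsCompact S := by
      have hclosed : IsClosed {x | ∀ y, ψ x + V x c ≤ ψ y + V y c} := by
        simp only [Set.ofPred_forall]
        exact isClosed_iInter fun y => isClosed_le (hHc c) continuous_const
      have himage := ((isCompact_unitCube d).inter_right hclosed).image
        (continuous_gradient_right hV c)
      refine (?_ : _ = S) ▸ himage
      refine (Set.ext fun w => ?_).symm
      constructor
      · rintro ⟨x, hx, rfl⟩
        obtain ⟨u, hu, hxu⟩ := exists_add_mem_unitCube x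
        refine ⟨x + u, ⟨hxu, fun y => ?_⟩, ?_⟩
        · rw [hψper x u hu, hVper x u c hu]
          exact hx y
        · simp only [hVper x u _ hu]
      · rintro ⟨x, ⟨-, hx⟩, rfl⟩
        exact ⟨x, hx, rfl⟩
    by_contra hvS
    obtain ⟨f, u, hfv, hfS⟩ := geometric_hahn_banach_point_closed (convex_convexHull ℝ S)
      (isCompact_convexHull hScompact).isClosed hvS
    obtain ⟨x, hx, hle⟩ := exists_minimizer_inner_gradient_le hψc hψper hV hVper hK hv
      ((InnerProductSpace.toDual ℝ _).symm f)
    have hlt := hfS _ (subset_convexHull ℝ S ⟨x, hx, rfl⟩)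
    rw [real_inner_comm, real_inner_comm _ v, InnerProductSpace.toDual_symm_apply,
      InnerProductSpace.toDual_symm_apply] at hle
    linarith
end
end

section
/- (Differentiability of the value function and the conjugate minimizer) Assume ψ is semi-concave, ‖∂²_{cc}V(x,c)‖ ≤ K for all (x,c), and for each c the map x ↦ ∂_cV(x,c) is one-to-one modulo ℤ^d. Then for Lebesgue almost every c ∈ ℝ^M: G is differentiable at c, the set X(c) of minimizers of H(·,c) consists of a single point x(c) modulo ℤ^d, and DG(c) = ∂_cV(x(c),c). -/
open MeasureTheory
open scoped RealInnerProductSpace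

noncomputable section

theorem concaveOn_univ_of_affine_majorant {E : Type*} [AddCommGroup E] [Module ℝ E] {g : E → ℝ}
    (h : ∀ x, ∃ l : E →ₗ[ℝ] ℝ, ∀ y, g y ≤ g x + l (y - x)) : ConcaveOn ℝ Set.univ g := by
  refine ⟨convex_univ, fun x _ y _ a b ha hb hab => ?_⟩
  obtain ⟨l, hl⟩ := h (a • x + b • y)
  have h1 := mul_le_mul_of_nonneg_left (hl x) ha
  have h2 := mul_le_mul_of_nonneg_left (hl y) hb
  simp only [map_sub, map_add, map_smul, smul_eq_mul] at h1 h2 ⊢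
  obtain rfl : b = 1 - a := by linarith
  linarith

theorem SemiConcaveWith.continuous {E : Type*} [NormedAddCommGroup E] [InnerProductSpace ℝ E]
    [FiniteDimensional ℝ E] {C : ℝ} {f : E → ℝ} (hf : SemiConcaveWith C f) : Continuous f := by
  have hconc : ConcaveOn ℝ Set.univ fun x => f x - C / 2 * ‖x‖ ^ 2 := by
    refine concaveOn_univ_of_affine_majorant fun x => ?_
    obtain ⟨l, hl⟩ := hf x
    refine ⟨(l - C • innerSL ℝ x).toLinearMap, fun y => ?_⟩
    have h1 := hl y
    have h2 : ‖y - x‖ ^ 2 = ‖y‖ ^ 2 - 2 * ⟪x, y⟫ + ‖x‖ ^ 2 := by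
      rw [norm_sub_sq_real, real_inner_comm]
    rw [h2] at h1
    simp only [ContinuousLinearMap.coe_coe, sub_apply, smul_apply, innerSL_apply_apply,
      smul_eq_mul, inner_sub_right, real_inner_self_eq_norm_sq]
    linarith
  have hcont := continuousOn_univ.1 (hconc.continuousOn isOpen_univ)
  simpa using hcont.fun_add (by fun_prop : Continuous fun x : E => C / 2 * ‖x‖ ^ 2)

theorem exists_isIntVec_norm_add_le {d : ℕ} (x : EuclideanSpace ℝ (Fin d)) :
    ∃ v, IsIntVec v ∧ ‖x + v‖ ≤ √d := by
  refine ⟨WithLp.toLp 2 fun i => ((-⌊x i⌋ : ℤ) : ℝ), fun i => ⟨-⌊x i⌋, rfl⟩, ?_⟩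
  rw [EuclideanSpace.norm_eq]
  refine Real.sqrt_le_sqrt ?_
  calc _ ≤ ∑ _i : Fin d, (1 : ℝ) := Finset.sum_le_sum fun i _ => ?_
    _ = d := by simp
  have h0 := Int.floor_le (x i)
  have h1 := (Int.lt_floor_add_one (x i)).le
  rw [sq_le_one_iff_abs_le_one, abs_norm, Real.norm_eq_abs, abs_le]
  simp only [PiLp.add_apply, Int.cast_neg]
  constructor <;> linarith

theorem exists_forall_le_of_periodic {d : ℕ} {h : EuclideanSpace ℝ (Fin d) → ℝ}
    (hcont : Continuous h) (hper : ∀ x v, IsIntVec v → h (x + v) = h x) :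
    ∃ x ∈ Metric.closedBall (0 : EuclideanSpace ℝ (Fin d)) √d, ∀ y, h x ≤ h y := by
  obtain ⟨x, hx, hmin⟩ := (isCompact_closedBall (0 : EuclideanSpace ℝ (Fin d)) √d).exists_isMinOn
    ⟨0, Metric.mem_closedBall_self (Real.sqrt_nonneg _)⟩ hcont.continuousOn
  refine ⟨x, hx, fun y => ?_⟩
  obtain ⟨v, hv, hyv⟩ := exists_isIntVec_norm_add_le y
  rw [← hper y v hv]
  exact hmin (mem_closedBall_zero_iff.2 hyv)

section ValueFun

variable {d M : ℕ} {ψ : EuclideanSpace ℝ (Fin d) → ℝ}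
  {V : EuclideanSpace ℝ (Fin d) → EuclideanSpace ℝ (Fin M) → ℝ}

theorem valueFun_eq_of_forall_le {c : EuclideanSpace ℝ (Fin M)} {x : EuclideanSpace ℝ (Fin d)}
    (hx : ∀ y, ψ x + V x c ≤ ψ y + V y c) : valueFun ψ V c = ψ x + V x c :=
  IsLeast.csInf_eq ⟨⟨x, rfl⟩, by rintro _ ⟨y, rfl⟩; exact hx y⟩

theorem hasGradientAt_valueFun_of_forall_le
    (hattained : ∀ c, ∃ x, ∀ y, ψ x + V x c ≤ ψ y + V y c)
    {c : EuclideanSpace ℝ (Fin M)} {x : EuclideanSpace ℝ (Fin d)}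
    (hV : DifferentiableAt ℝ (fun c' => V x c') c) (hG : DifferentiableAt ℝ (valueFun ψ V) c)
    (hx : ∀ y, ψ x + V x c ≤ ψ y + V y c) :
    HasGradientAt (valueFun ψ V) (gradient (fun c' => V x c') c) c := by
  have hmin : IsLocalMin ((fun c' => V x c') - valueFun ψ V) c := by
    refine Filter.Eventually.of_forall fun c' => ?_
    obtain ⟨z, hz⟩ := hattained c'
    simp only [Pi.sub_apply, valueFun_eq_of_forall_le hx, valueFun_eq_of_forall_le hz]
    linarith [hz x]
  have hfd := hmin.hasFDerivAt_eq_zero (hV.hasFDerivAt.sub hG.hasFDerivAt)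
  have hgrad : gradient (fun c' => V x c') c = gradient (valueFun ψ V) c := by
    rw [gradient, gradient, sub_eq_zero.1 hfd]
  exact hgrad ▸ hG.hasGradientAt

theorem lipschitzOnWith_valueFun {s : Set (EuclideanSpace ℝ (Fin d))}
    {t : Set (EuclideanSpace ℝ (Fin M))} {L : NNReal}
    (hattained : ∀ c, ∃ x ∈ s, ∀ y, ψ x + V x c ≤ ψ y + V y c)
    (hL : ∀ x ∈ s, LipschitzOnWith L (fun c => V x c) t) :
    LipschitzOnWith L (valueFun ψ V) t := by
  refine LipschitzOnWith.of_le_add_mul L fun c hc c' hc' => ?_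
  obtain ⟨x, -, hx⟩ := hattained c
  obtain ⟨x', hx's, hx'⟩ := hattained c'
  rw [valueFun_eq_of_forall_le hx, valueFun_eq_of_forall_le hx']
  have := (lipschitzOnWith_iff_dist_le_mul.1 (hL x' hx's)) c hc c' hc'
  rw [Real.dist_eq] at this
  linarith [hx x', le_abs_self (V x' c - V x' c')]

theorem ae_differentiableAt_valueFun {s : Set (EuclideanSpace ℝ (Fin d))} (hs : IsCompact s)
    (hconv : Convex ℝ s)
    (hV : ContDiff ℝ 1 fun p : EuclideanSpace ℝ (Fin d) × EuclideanSpace ℝ (Fin M) => V p.1 p.2)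
    (hattained : ∀ c, ∃ x ∈ s, ∀ y, ψ x + V x c ≤ ψ y + V y c) :
    ∀ᵐ c, DifferentiableAt ℝ (valueFun ψ V) c := by
  have hball : ∀ n : ℕ, ∀ᵐ c, c ∈ Metric.closedBall (0 : EuclideanSpace ℝ (Fin M)) n →
      DifferentiableWithinAt ℝ (valueFun ψ V) (Metric.closedBall 0 n) c := fun n => by
    obtain ⟨L, hL⟩ := hV.contDiffOn.exists_lipschitzOnWith one_ne_zero
      (hconv.prod (convex_closedBall (0 : EuclideanSpace ℝ (Fin M)) n))
      (hs.prod (isCompact_closedBall _ _))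
    refine (lipschitzOnWith_valueFun (L := L) hattained
      fun x hx => ?_).ae_differentiableWithinAt_of_mem
    refine LipschitzOnWith.of_dist_le_mul fun c hc c' hc' => ?_
    simpa [Prod.dist_eq] using hL.dist_le_mul (x, c) ⟨hx, hc⟩ (x, c') ⟨hx, hc'⟩
  filter_upwards [ae_all_iff.2 hball] with c hc
  obtain ⟨n, hn⟩ := exists_nat_gt ‖c‖
  exact (hc n (mem_closedBall_zero_iff.2 hn.le)).differentiableAt
    (Metric.closedBall_mem_nhds_of_mem (mem_ball_zero_iff.2 hn))

end ValueFun

/-- **Differentiability of the value function and the conjugate minimizer.** If `ψ` is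
semi-concave and periodic, `‖∂²_{cc}V‖ ≤ K`, and `x ↦ ∂_c V(x,c)` is one-to-one mod `ℤ^d`,
then for Lebesgue a.e. `c`: `G` is differentiable at `c`, the minimizer `x(c)` of `H(·,c)`
is unique mod `ℤ^d`, and `DG(c) = ∂_c V(x(c),c)`. -/
theorem value_function_differentiable_ae
    (d M : ℕ) (hd : 1 ≤ d)
    (ψ : EuclideanSpace ℝ (Fin d) → ℝ)
    (hψper : ∀ x v, IsIntVec v → ψ (x + v) = ψ x)
    (hψsc : ∃ C > 0, SemiConcaveWith C ψ)
    (V : EuclideanSpace ℝ (Fin d) → EuclideanSpace ℝ (Fin M) → ℝ)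
    (hV : ContDiff ℝ 2 fun p : EuclideanSpace ℝ (Fin d) × EuclideanSpace ℝ (Fin M) =>
      V p.1 p.2)
    (hVper : ∀ x v c, IsIntVec v → V (x + v) c = V x c)
    (K : ℝ) (hK0 : 0 ≤ K)
    (hK : ∀ x c, ‖iteratedFDeriv ℝ 2 (fun c' => V x c') c‖ ≤ K)
    (hinj : ∀ (c : EuclideanSpace ℝ (Fin M)) (x y : EuclideanSpace ℝ (Fin d)),
      gradient (fun c' => V x c') c = gradient (fun c' => V y c') c → IsIntVec (x - y)) :
    ∀ᵐ c ∂(volume : Measure (EuclideanSpace ℝ (Fin M))),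
      ∃ x : EuclideanSpace ℝ (Fin d),
        (∀ y, ψ x + V x c ≤ ψ y + V y c) ∧
        (∀ y, (∀ z, ψ y + V y c ≤ ψ z + V z c) → IsIntVec (y - x)) ∧
        HasGradientAt (valueFun ψ V) (gradient (fun c' => V x c') c) c := by
  obtain ⟨C, -, hC⟩ := hψsc
  have hψ := hC.continuous
  have hattained : ∀ c, ∃ x ∈ Metric.closedBall (0 : EuclideanSpace ℝ (Fin d)) √d,
      ∀ y, ψ x + V x c ≤ ψ y + V y c := fun c =>
    exists_forall_le_of_periodic (h := fun x => ψ x + V x c)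
      (hψ.add (hV.continuous.comp (by fun_prop : Continuous fun x => (x, c))))
      fun x v hv => by rw [hψper x v hv, hVper x v c hv]
  have hattained' : ∀ c, ∃ x, ∀ y, ψ x + V x c ≤ ψ y + V y c := fun c =>
    let ⟨x, _, hx⟩ := hattained c
    ⟨x, hx⟩
  have hVdiff : ∀ x c, DifferentiableAt ℝ (fun c' => V x c') c := fun x c =>
    ((hV.comp (contDiff_prodMk_right x)).differentiable two_ne_zero) c
  filter_upwards [ae_differentiableAt_valueFun (isCompact_closedBall _ _) (convex_closedBall _ _)
    (hV.of_le one_le_two) hattained] with c hG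
  obtain ⟨x, hx⟩ := hattained' c
  have hgrad := fun y => hasGradientAt_valueFun_of_forall_le (x := y) hattained' (hVdiff y c) hG
  exact ⟨x, hx, fun y hy => hinj c y x ((hgrad y hy).unique (hgrad x hx)), hgrad x hx⟩
end
end
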